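/- Let N and T be cocommutative Hopf algebras over a field k acting trivially on each other, and let A be a commutative k-algebra. Then measuring 1-coboundaries for the trivial action are trivial, and H¹_meas(T,Hom(N,A)) is isomorphic to P(T,N,A), the abelian group under pointwise convolution of linear maps f: T⊗N → A that measure in both variables, i.e. ∑ f(t_(1)⊗n) f(t_(2)⊗n') = f(t⊗nn'), f(t⊗1_N) = ε(t)1_A, ∑ f(t⊗n_(1)) f(t'⊗n_(2)) = f(tt'⊗n), and f(1_T⊗n) = ε(n)1_A. -/

import Mathlib

open TensorProduct

namespace SmashPaper

variable (k : Type) [Field k]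

section Conv

variable {k : Type} [Field k] {C A : Type} [AddCommGroup C] [Module k C] [Coalgebra k C]
  [CommRing A] [Algebra k A]

/-- Convolution product on linear maps from a coalgebra to an algebra. -/
noncomputable def conv (f g : C →ₗ[k] A) : C →ₗ[k] A :=
  LinearMap.mul' k A ∘ₗ TensorProduct.map f g ∘ₗ Coalgebra.comul

/-- Convolution unit. -/
noncomputable def convOne (C A : Type) [AddCommGroup C] [Module k C] [Coalgebra k C]
    [CommRing A] [Algebra k A] : C →ₗ[k] A :=
  Algebra.linearMap k A ∘ₗ Coalgebra.counit

def IsConvInv (f g : C →ₗ[k] A) : Prop :=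
  conv f g = convOne C A ∧ conv g f = convOne C A

def IsConvInvertible (f : C →ₗ[k] A) : Prop := ∃ g, IsConvInv f g

end Conv

/-- Cocommutativity of a coalgebra. -/
def IsCocomm (C : Type) [AddCommGroup C] [Module k C] [Coalgebra k C] : Prop :=
  (TensorProduct.comm k C C).toLinearMap ∘ₗ Coalgebra.comul
    = (Coalgebra.comul : C →ₗ[k] C ⊗[k] C)

section Drop

variable {k : Type} [Field k] (C D : Type) [AddCommGroup C] [Module k C]
  [AddCommGroup D] [Module k D]

/-- `c ⊗ d ↦ ε(c) d`. -/
noncomputable def dropL [Coalgebra k C] : C ⊗[k] D →ₗ[k] D :=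
  (TensorProduct.lid k D).toLinearMap ∘ₗ LinearMap.rTensor D (Coalgebra.counit (R := k))

/-- `c ⊗ d ↦ ε(d) c`. -/
noncomputable def dropR [Coalgebra k D] : C ⊗[k] D →ₗ[k] C :=
  (TensorProduct.rid k C).toLinearMap ∘ₗ LinearMap.lTensor C (Coalgebra.counit (R := k))

end Drop

section Sweedler

variable {k : Type} [Field k] (H A : Type) [Ring H] [Bialgebra k H]
  [CommRing A] [Algebra k A]

variable {H A}

/-- Normalization for 1-cochains. -/
def Normalized1 (t : H →ₗ[k] A) : Prop := t 1 = 1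

/-- Normalization for 2-cochains: trivial whenever an argument is a scalar. -/
def Normalized2 (f : H ⊗[k] H →ₗ[k] A) : Prop :=
  ∀ x : H, f (1 ⊗ₜ[k] x) = algebraMap k A (Coalgebra.counit x)
    ∧ f (x ⊗ₜ[k] 1) = algebraMap k A (Coalgebra.counit x)

/-- Normalization for 3-cochains. -/
def Normalized3 (f : (H ⊗[k] H) ⊗[k] H →ₗ[k] A) : Prop :=
  ∀ x y : H,
    f ((1 ⊗ₜ[k] x) ⊗ₜ[k] y) = algebraMap k A (Coalgebra.counit x * Coalgebra.counit y)
    ∧ f ((x ⊗ₜ[k] 1) ⊗ₜ[k] y) = algebraMap k A (Coalgebra.counit x * Coalgebra.counit y)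
    ∧ f ((x ⊗ₜ[k] y) ⊗ₜ[k] 1) = algebraMap k A (Coalgebra.counit x * Coalgebra.counit y)

/-- `∑ f(x₍₁₎ ⊗ y₍₁₎) f(x₍₂₎y₍₂₎ ⊗ z)` as a linear map on `(H ⊗ H) ⊗ H`. -/
noncomputable def cocycle2LHS (f : H ⊗[k] H →ₗ[k] A) : (H ⊗[k] H) ⊗[k] H →ₗ[k] A :=
  conv (f ∘ₗ dropR (H ⊗[k] H) H) (f ∘ₗ LinearMap.rTensor H (LinearMap.mul' k H))

/-- `∑ f(y₍₁₎ ⊗ z₍₁₎) f(x ⊗ y₍₂₎z₍₂₎)` as a linear map on `(H ⊗ H) ⊗ H`. -/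
noncomputable def cocycle2RHS (f : H ⊗[k] H →ₗ[k] A) : (H ⊗[k] H) ⊗[k] H →ₗ[k] A :=
  conv (f ∘ₗ dropL H (H ⊗[k] H) ∘ₗ (TensorProduct.assoc k H H H).toLinearMap)
       (f ∘ₗ LinearMap.lTensor H (LinearMap.mul' k H) ∘ₗ (TensorProduct.assoc k H H H).toLinearMap)

/-- Sweedler 2-cocycles (for the trivial action). -/
def IsZ2 (f : H ⊗[k] H →ₗ[k] A) : Prop :=
  Normalized2 f ∧ IsConvInvertible f ∧ cocycle2LHS f = cocycle2RHS f

/-- The Sweedler 2-coboundary `∑ t(y₍₁₎) t⁻¹(x₍₁₎y₍₂₎) t(x₍₂₎)` of a 1-cochain `t`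
with convolution inverse `tinv`. -/
noncomputable def cobound2 (t tinv : H →ₗ[k] A) : H ⊗[k] H →ₗ[k] A :=
  conv (t ∘ₗ dropL H H) (conv (tinv ∘ₗ LinearMap.mul' k H) (t ∘ₗ dropR H H))

/-- Sweedler 2-coboundaries (for the trivial action). -/
def IsB2 (f : H ⊗[k] H →ₗ[k] A) : Prop :=
  ∃ t tinv : H →ₗ[k] A, Normalized1 t ∧ IsConvInv t tinv ∧ f = cobound2 t tinv

/-- Two 2-cochains are cohomologous when they differ (in convolution) by a 2-coboundary. -/
def Cohomologous2 (f f' : H ⊗[k] H →ₗ[k] A) : Prop :=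
  ∃ b, IsB2 b ∧ f = conv f' b

/-- `(x⊗y)⊗z ↦ x ⊗ yz`. -/
noncomputable def m23 : (H ⊗[k] H) ⊗[k] H →ₗ[k] H ⊗[k] H :=
  LinearMap.lTensor H (LinearMap.mul' k H) ∘ₗ (TensorProduct.assoc k H H H).toLinearMap

/-- `(x⊗y)⊗z ↦ ε(x) (y⊗z)`. -/
noncomputable def p23 : (H ⊗[k] H) ⊗[k] H →ₗ[k] H ⊗[k] H :=
  dropL H (H ⊗[k] H) ∘ₗ (TensorProduct.assoc k H H H).toLinearMap

/-- 3-cocycle condition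
`∑ f(y₁⊗z₁⊗w₁) f(x₁⊗y₂z₂⊗w₂) f(x₂⊗y₃⊗z₃) = ∑ f(x₁y₁⊗z₁⊗w₁) f(x₂⊗y₂⊗z₂w₂)`. -/
def IsZ3cond (f : (H ⊗[k] H) ⊗[k] H →ₗ[k] A) : Prop :=
  conv (f ∘ₗ LinearMap.rTensor H (LinearMap.rTensor H (dropL H H)))
    (conv (f ∘ₗ LinearMap.rTensor H (m23 (H := H)))
          (f ∘ₗ dropR ((H ⊗[k] H) ⊗[k] H) H))
  = conv (C := ((H ⊗[k] H) ⊗[k] H) ⊗[k] H)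
         (f ∘ₗ LinearMap.rTensor H (LinearMap.rTensor H (LinearMap.mul' k H)))
         (f ∘ₗ (LinearMap.lTensor (H ⊗[k] H) (LinearMap.mul' k H)
              ∘ₗ (TensorProduct.assoc k (H ⊗[k] H) H H).toLinearMap :
                ((H ⊗[k] H) ⊗[k] H) ⊗[k] H →ₗ[k] (H ⊗[k] H) ⊗[k] H))

/-- Sweedler 3-cocycles (for the trivial action). -/
def IsZ3 (f : (H ⊗[k] H) ⊗[k] H →ₗ[k] A) : Prop :=
  Normalized3 f ∧ IsConvInvertible f ∧ IsZ3cond f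

/-- The Sweedler 3-coboundary
`∑ v(y₁⊗z₁) v⁻¹(x₁y₂⊗z₂) v(x₂⊗y₃z₃) v⁻¹(x₃⊗y₄)` of a 2-cochain `v`. -/
noncomputable def cobound3 (v vinv : H ⊗[k] H →ₗ[k] A) : (H ⊗[k] H) ⊗[k] H →ₗ[k] A :=
  conv (v ∘ₗ p23 (H := H))
    (conv (vinv ∘ₗ LinearMap.rTensor H (LinearMap.mul' k H))
      (conv (v ∘ₗ m23 (H := H)) (vinv ∘ₗ dropR (H ⊗[k] H) H)))

/-- Sweedler 3-coboundaries (for the trivial action). -/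
def IsB3 (f : (H ⊗[k] H) ⊗[k] H →ₗ[k] A) : Prop :=
  ∃ v vinv : H ⊗[k] H →ₗ[k] A, Normalized2 v ∧ IsConvInv v vinv ∧ f = cobound3 v vinv

/-- Cohomologous 3-cochains. -/
def Cohomologous3 (f f' : (H ⊗[k] H) ⊗[k] H →ₗ[k] A) : Prop :=
  ∃ b, IsB3 b ∧ f = conv f' b

end Sweedler

section Measuring

variable {k : Type} [Field k]
variable {C : Type} [AddCommGroup C] [Module k C] [Coalgebra k C]
variable {N : Type} [Ring N] [Bialgebra k N]
variable {A : Type} [CommRing A] [Algebra k A]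

/-- `(C, θ)` measures `N` to `A`:
`∑ θ(c₍₁₎ ⊗ n) θ(c₍₂₎ ⊗ n') = θ(c ⊗ nn')` and `θ(c ⊗ 1) = ε(c) 1`. -/
def Measures (θ : C ⊗[k] N →ₗ[k] A) : Prop :=
  (θ ∘ₗ LinearMap.lTensor C (LinearMap.mul' k N)
    = conv (θ ∘ₗ LinearMap.lTensor C (dropR N N)) (θ ∘ₗ LinearMap.lTensor C (dropL N N)))
  ∧ ∀ c : C, θ (c ⊗ₜ[k] (1 : N)) = algebraMap k A (Coalgebra.counit c)

end Measuring

section Action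

variable {k : Type} [Field k]
variable {T N : Type} [Ring T] [Bialgebra k T] [Ring N] [Bialgebra k N]

/-- `μ : T ⊗ N → N` makes `N` a left `T`-module bialgebra. -/
structure IsModuleBialgebra (μ : T ⊗[k] N →ₗ[k] N) : Prop where
  one_act : ∀ n : N, μ ((1 : T) ⊗ₜ[k] n) = n
  mul_act : ∀ (t s : T) (n : N), μ ((t * s) ⊗ₜ[k] n) = μ (t ⊗ₜ[k] μ (s ⊗ₜ[k] n))
  act_one : ∀ t : T, μ (t ⊗ₜ[k] (1 : N)) = algebraMap k N (Coalgebra.counit t)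
  act_mul : μ ∘ₗ LinearMap.lTensor T (LinearMap.mul' k N)
      = LinearMap.mul' k N ∘ₗ TensorProduct.map μ μ
          ∘ₗ (TensorProduct.tensorTensorTensorComm k T T N N).toLinearMap
          ∘ₗ LinearMap.rTensor (N ⊗[k] N) Coalgebra.comul
  comul_act : Coalgebra.comul ∘ₗ μ
      = TensorProduct.map μ μ
          ∘ₗ (TensorProduct.tensorTensorTensorComm k T T N N).toLinearMap
          ∘ₗ TensorProduct.map Coalgebra.comul Coalgebra.comul
  counit_act : ∀ (t : T) (n : N),
      Coalgebra.counit (R := k) (μ (t ⊗ₜ[k] n))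
        = Coalgebra.counit (R := k) t * Coalgebra.counit (R := k) n

/-- `t ⊗ n ↦ ∑ t₍₁₎(n) ⊗ t₍₂₎`. -/
noncomputable def smashCross (μ : T ⊗[k] N →ₗ[k] N) : T ⊗[k] N →ₗ[k] N ⊗[k] T :=
  TensorProduct.map μ LinearMap.id
    ∘ₗ (TensorProduct.assoc k T N T).symm.toLinearMap
    ∘ₗ LinearMap.lTensor T (TensorProduct.comm k T N).toLinearMap
    ∘ₗ (TensorProduct.assoc k T T N).toLinearMap
    ∘ₗ LinearMap.rTensor N Coalgebra.comul

variable {H : Type} [Ring H] [Bialgebra k H]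

/-- `H` is the smash product `N ⋊ T` along the action `μ`, with `N` and `T` included
as the Hopf subalgebras `N ⋊ 1` and `1 ⋊ T`; we identify `n ⋊ t = n t`. -/
structure IsSmashProduct (μ : T ⊗[k] N →ₗ[k] N) (iN : N →ₐc[k] H) (iT : T →ₐc[k] H) : Prop where
  act : IsModuleBialgebra μ
  injN : Function.Injective iN
  injT : Function.Injective iT
  /-- `n ⊗ t ↦ (n ⋊ 1)(1 ⋊ t)` is a linear isomorphism `N ⊗ T ≅ H` (`H` is the
  tensor product coalgebra `N ⊗ T`). -/
  bij : Function.Bijective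
    (LinearMap.mul' k H ∘ₗ TensorProduct.map (iN : N →ₗ[k] H) (iT : T →ₗ[k] H))
  /-- The smash relation `t n = ∑ t₍₁₎(n) t₍₂₎` in `H`. -/
  straighten : LinearMap.mul' k H ∘ₗ TensorProduct.map (iT : T →ₗ[k] H) (iN : N →ₗ[k] H)
      = LinearMap.mul' k H ∘ₗ TensorProduct.map (iN : N →ₗ[k] H) (iT : T →ₗ[k] H)
          ∘ₗ smashCross μ

end Action

section MeasCohomology

variable {k : Type} [Field k]
variable {T N : Type} [Ring T] [Bialgebra k T] [Ring N] [Bialgebra k N]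
variable {A : Type} [CommRing A] [Algebra k A]

/-- Normalization in the `T`-variable for measuring 1-cochains `T ⊗ N → A`. -/
def MeasNormalized1 (f : T ⊗[k] N →ₗ[k] A) : Prop :=
  ∀ n : N, f ((1 : T) ⊗ₜ[k] n) = algebraMap k A (Coalgebra.counit n)

/-- A measuring 1-cochain: an element of `Reg_meas(T, Hom(N,A))`. -/
def IsRegMeas1 (f : T ⊗[k] N →ₗ[k] A) : Prop :=
  Measures f ∧ MeasNormalized1 f ∧ IsConvInvertible f

/-- The measuring 1-cocycle condition `f(ts)(n) = ∑ f(s₍₁₎)(n₍₁₎) f(t)(s₍₂₎(n₍₂₎))`. -/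
def MeasCocycle1 (μ : T ⊗[k] N →ₗ[k] N) (f : T ⊗[k] N →ₗ[k] A) : Prop :=
  f ∘ₗ LinearMap.rTensor N (LinearMap.mul' k T)
    = conv (f ∘ₗ LinearMap.rTensor N (dropL T T))
      (f ∘ₗ LinearMap.lTensor T μ ∘ₗ (TensorProduct.assoc k T T N).toLinearMap)

/-- Measuring 1-cocycles. -/
def IsMeasZ1 (μ : T ⊗[k] N →ₗ[k] N) (f : T ⊗[k] N →ₗ[k] A) : Prop :=
  IsRegMeas1 f ∧ MeasCocycle1 μ f

/-- Measuring 1-coboundaries: `f(t)(n) = ∑ g(n₍₁₎) g⁻¹(t(n₍₂₎))` for a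
convolution-invertible algebra map `g : N → A`. -/
def IsMeasB1 (μ : T ⊗[k] N →ₗ[k] N) (f : T ⊗[k] N →ₗ[k] A) : Prop :=
  ∃ (g : N →ₐ[k] A) (ginv : N →ₗ[k] A), IsConvInv g.toLinearMap ginv ∧
    f = conv (g.toLinearMap ∘ₗ dropL T N) (ginv ∘ₗ μ)

/-- Normalization for measuring 2-cochains `(T ⊗ T) ⊗ N → A`. -/
def MeasNormalized2 (f : (T ⊗[k] T) ⊗[k] N →ₗ[k] A) : Prop :=
  ∀ (t : T) (n : N),
    f (((1 : T) ⊗ₜ[k] t) ⊗ₜ[k] n)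
        = algebraMap k A (Coalgebra.counit t * Coalgebra.counit n)
    ∧ f ((t ⊗ₜ[k] (1 : T)) ⊗ₜ[k] n)
        = algebraMap k A (Coalgebra.counit t * Coalgebra.counit n)

/-- A measuring 2-cochain: an element of `Reg_meas(T ⊗ T, Hom(N,A))`. -/
def IsRegMeas2 (f : (T ⊗[k] T) ⊗[k] N →ₗ[k] A) : Prop :=
  Measures f ∧ MeasNormalized2 f ∧ IsConvInvertible f

/-- The measuring 2-cocycle condition
`∑ f(t₍₁₎⊗s₍₁₎)(r₍₁₎(n₍₁₎)) f(t₍₂₎s₍₂₎⊗r₍₂₎)(n₍₂₎) = ∑ f(s₍₁₎⊗r₍₁₎)(n₍₁₎) f(t⊗s₍₂₎r₍₂₎)(n₍₂₎)`. -/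
def MeasCocycle2 (μ : T ⊗[k] N →ₗ[k] N) (f : (T ⊗[k] T) ⊗[k] N →ₗ[k] A) : Prop :=
  conv (C := ((T ⊗[k] T) ⊗[k] T) ⊗[k] N)
       (f ∘ₗ (LinearMap.lTensor (T ⊗[k] T) μ
          ∘ₗ (TensorProduct.assoc k (T ⊗[k] T) T N).toLinearMap :
            ((T ⊗[k] T) ⊗[k] T) ⊗[k] N →ₗ[k] (T ⊗[k] T) ⊗[k] N))
       (f ∘ₗ LinearMap.rTensor N (LinearMap.rTensor T (LinearMap.mul' k T)))
    = conv (C := ((T ⊗[k] T) ⊗[k] T) ⊗[k] N)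
           (f ∘ₗ LinearMap.rTensor N (LinearMap.rTensor T (dropL T T)))
           (f ∘ₗ LinearMap.rTensor N
              ((LinearMap.lTensor T (LinearMap.mul' k T)
                ∘ₗ (TensorProduct.assoc k T T T).toLinearMap :
                  (T ⊗[k] T) ⊗[k] T →ₗ[k] T ⊗[k] T)))

/-- Measuring 2-cocycles. -/
def IsMeasZ2 (μ : T ⊗[k] N →ₗ[k] N) (f : (T ⊗[k] T) ⊗[k] N →ₗ[k] A) : Prop :=
  IsRegMeas2 f ∧ MeasCocycle2 μ f

/-- The measuring coboundary
`(t ⊗ s ⊗ n) ↦ ∑ g(s₍₁₎)(n₍₁₎) g⁻¹(t₍₁₎s₍₂₎)(n₍₂₎) g(t₍₂₎)(s₍₃₎(n₍₃₎))`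
of a 1-cochain `g` with convolution inverse `ginv`.  (For a 2-cocycle `f` on `N` with
stability witness `g`, this same formula is the map `d`. ) -/
noncomputable def measCobound (μ : T ⊗[k] N →ₗ[k] N) (g ginv : T ⊗[k] N →ₗ[k] A) :
    (T ⊗[k] T) ⊗[k] N →ₗ[k] A :=
  conv (g ∘ₗ LinearMap.rTensor N (dropL T T))
    (conv (ginv ∘ₗ LinearMap.rTensor N (LinearMap.mul' k T))
          (g ∘ₗ LinearMap.lTensor T μ ∘ₗ (TensorProduct.assoc k T T N).toLinearMap))

/-- Measuring 2-coboundaries. -/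
def IsMeasB2 (μ : T ⊗[k] N →ₗ[k] N) (f : (T ⊗[k] T) ⊗[k] N →ₗ[k] A) : Prop :=
  ∃ g ginv : T ⊗[k] N →ₗ[k] A, IsRegMeas1 g ∧ IsConvInv g ginv ∧ f = measCobound μ g ginv

/-- Cohomologous measuring 2-cochains. -/
def MeasCohomologous2 (μ : T ⊗[k] N →ₗ[k] N) (f f' : (T ⊗[k] T) ⊗[k] N →ₗ[k] A) : Prop :=
  ∃ b, IsMeasB2 μ b ∧ f = conv f' b

/-- `∑ f(n₍₁₎ ⊗ n'₍₁₎) f⁻¹(t₍₁₎(n₍₂₎) ⊗ t₍₂₎(n'₍₂₎))` as a map `T ⊗ (N ⊗ N) → A`. -/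
noncomputable def stabLHS (μ : T ⊗[k] N →ₗ[k] N) (f finv : N ⊗[k] N →ₗ[k] A) :
    T ⊗[k] (N ⊗[k] N) →ₗ[k] A :=
  conv (f ∘ₗ dropL T (N ⊗[k] N))
       (finv ∘ₗ TensorProduct.map μ μ
          ∘ₗ (TensorProduct.tensorTensorTensorComm k T T N N).toLinearMap
          ∘ₗ LinearMap.rTensor (N ⊗[k] N) Coalgebra.comul)

/-- `∑ g(t₍₁₎ ⊗ n₍₁₎) g⁻¹(t₍₂₎ ⊗ n₍₂₎n'₍₁₎) g(t₍₃₎ ⊗ n'₍₂₎)` as a map `T ⊗ (N ⊗ N) → A`. -/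
noncomputable def stabRHS (g ginv : T ⊗[k] N →ₗ[k] A) : T ⊗[k] (N ⊗[k] N) →ₗ[k] A :=
  conv (g ∘ₗ LinearMap.lTensor T (dropR N N))
    (conv (ginv ∘ₗ LinearMap.lTensor T (LinearMap.mul' k N))
          (g ∘ₗ LinearMap.lTensor T (dropL N N)))

/-- `g` (with convolution inverse `ginv`) witnesses the `T`-stability of the
2-cochain `f` on `N` (with convolution inverse `finv`):
`f * (f⁻¹)ᵗ = δ'(g(t ⊗ _))`. -/
def IsStabilityWitness (μ : T ⊗[k] N →ₗ[k] N) (f finv : N ⊗[k] N →ₗ[k] A)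
    (g ginv : T ⊗[k] N →ₗ[k] A) : Prop :=
  MeasNormalized1 g ∧ (∀ t : T, g (t ⊗ₜ[k] (1 : N)) = algebraMap k A (Coalgebra.counit t))
    ∧ IsConvInv g ginv ∧ stabLHS μ f finv = stabRHS g ginv

/-- The cohomology class of the 2-cocycle `f` on `N` is `T`-stable. -/
def IsTStable (μ : T ⊗[k] N →ₗ[k] N) (f finv : N ⊗[k] N →ₗ[k] A) : Prop :=
  ∃ g ginv, IsStabilityWitness μ f finv g ginv

end MeasCohomology

section SmashStatements

variable {k : Type} [Field k]
variable {T N H A : Type} [Ring T] [Bialgebra k T] [Ring N] [Bialgebra k N]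
  [Ring H] [Bialgebra k H] [CommRing A] [Algebra k A]

/-- `n ⊗ t ↦ (n ⋊ 1)(1 ⋊ t) = n ⋊ t`. -/
noncomputable def smashMul (iN : N →ₐc[k] H) (iT : T →ₐc[k] H) : N ⊗[k] T →ₗ[k] H :=
  LinearMap.mul' k H ∘ₗ TensorProduct.map iN.toLinearMap iT.toLinearMap

/-- The restriction of a 2-cochain on `H` to `N ⊗ N`. -/
noncomputable def resNN (iN : N →ₐc[k] H) (f : H ⊗[k] H →ₗ[k] A) : N ⊗[k] N →ₗ[k] A :=
  f ∘ₗ TensorProduct.map iN.toLinearMap iN.toLinearMap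

/-- The restriction of a 2-cochain on `H` to `T ⊗ T`. -/
noncomputable def resTT (iT : T →ₐc[k] H) (f : H ⊗[k] H →ₗ[k] A) : T ⊗[k] T →ₗ[k] A :=
  f ∘ₗ TensorProduct.map iT.toLinearMap iT.toLinearMap

/-- The restriction of a 2-cochain on `H` to `T ⊗ N`. -/
noncomputable def resTN (iN : N →ₐc[k] H) (iT : T →ₐc[k] H) (f : H ⊗[k] H →ₗ[k] A) :
    T ⊗[k] N →ₗ[k] A :=
  f ∘ₗ TensorProduct.map iT.toLinearMap iN.toLinearMap

/-- `f` is trivial on `N ⊗ T`: `f(n ⊗ t) = ε(n)ε(t)1`. -/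
def TrivialOnNT (iN : N →ₐc[k] H) (iT : T →ₐc[k] H) (f : H ⊗[k] H →ₗ[k] A) : Prop :=
  ∀ (n : N) (t : T), f (iN n ⊗ₜ[k] iT t)
    = algebraMap k A (Coalgebra.counit n * Coalgebra.counit t)

/-- `f` is trivial on `T ⊗ T`. -/
def TrivialOnTT (iT : T →ₐc[k] H) (f : H ⊗[k] H →ₗ[k] A) : Prop :=
  ∀ t t' : T, f (iT t ⊗ₜ[k] iT t')
    = algebraMap k A (Coalgebra.counit t * Coalgebra.counit t')

/-- `F` is the 2-cochain `ι f : (n ⋊ t) ⊗ (n' ⋊ t') ↦ ε(n) f(t)(n') ε(t')` on `H`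
associated with a measuring 1-cochain `f`. -/
def IotaOf (iN : N →ₐc[k] H) (iT : T →ₐc[k] H) (f : T ⊗[k] N →ₗ[k] A)
    (F : H ⊗[k] H →ₗ[k] A) : Prop :=
  ∀ (n : N) (t : T) (n' : N) (t' : T),
    F ((iN n * iT t) ⊗ₜ[k] (iN n' * iT t'))
      = algebraMap k A (Coalgebra.counit n * Coalgebra.counit t') * f (t ⊗ₜ[k] n')

/-- `J` is the 3-cochain
`jf : (n⋊t) ⊗ (n'⋊t') ⊗ (n''⋊t'') ↦ ε(n)ε(n') f(t⊗t')(n'') ε(t'')` on `H`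
associated with a measuring 2-cochain `f`. -/
def JOf (iN : N →ₐc[k] H) (iT : T →ₐc[k] H) (f : (T ⊗[k] T) ⊗[k] N →ₗ[k] A)
    (J : (H ⊗[k] H) ⊗[k] H →ₗ[k] A) : Prop :=
  ∀ (n : N) (t : T) (n' : N) (t' : T) (n'' : N) (t'' : T),
    J (((iN n * iT t) ⊗ₜ[k] (iN n' * iT t')) ⊗ₜ[k] (iN n'' * iT t''))
      = algebraMap k A (Coalgebra.counit n * Coalgebra.counit n' * Coalgebra.counit t'')
          * f ((t ⊗ₜ[k] t') ⊗ₜ[k] n'')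

end SmashStatements

end SmashPaper

open TensorProduct SmashPaper


/-- The condition that `f : T ⊗ N → A` measures in both variables, i.e. corresponds to
algebra maps `T → Hom(N,A)` and `N → Hom(T,A)`:
`∑ f(t₍₁₎⊗n) f(t₍₂₎⊗n') = f(t⊗nn')`, `f(t⊗1)=ε(t)1`,
`∑ f(t⊗n₍₁₎) f(t'⊗n₍₂₎) = f(tt'⊗n)`, and `f(1⊗n)=ε(n)1`. -/
def IsBimeasuring {k : Type} [Field k] {T N A : Type}
    [Ring T] [Bialgebra k T] [Ring N] [Bialgebra k N] [CommRing A] [Algebra k A]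
    (f : T ⊗[k] N →ₗ[k] A) : Prop :=
  Measures f ∧ MeasNormalized1 f
    ∧ (f ∘ₗ LinearMap.rTensor N (LinearMap.mul' k T)
        = conv (C := (T ⊗[k] T) ⊗[k] N)
            (f ∘ₗ LinearMap.rTensor N (dropR T T))
            (f ∘ₗ LinearMap.rTensor N (dropL T T)))

namespace SmashPaper

open WithConv

section Conv

variable {k : Type} [Field k] {C D A : Type} [AddCommGroup C] [Module k C] [Coalgebra k C]
  [AddCommGroup D] [Module k D] [Coalgebra k D] [CommRing A] [Algebra k A]

lemma toConv_conv (f g : C →ₗ[k] A) : toConv (conv f g) = toConv f * toConv g := rfl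

lemma toConv_convOne : toConv (convOne (k := k) C A) = 1 := rfl

lemma conv_one_one : conv (convOne (k := k) C A) (convOne C A) = convOne C A := by
  apply toConv_injective
  rw [toConv_conv, toConv_convOne, mul_one]

lemma conv_comp_coalgHom (f g : D →ₗ[k] A) (φ : C →ₗc[k] D) :
    conv f g ∘ₗ φ.toLinearMap = conv (f ∘ₗ φ.toLinearMap) (g ∘ₗ φ.toLinearMap) :=
  LinearMap.convMul_comp_coalgHom_distrib (toConv f) (toConv g) φ

lemma convOne_comp_coalgHom (φ : C →ₗc[k] D) :
    convOne D A ∘ₗ φ.toLinearMap = convOne C A := by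
  simp [convOne, LinearMap.comp_assoc]

lemma IsCocomm.coalgebra (h : IsCocomm k C) : Coalgebra.IsCocomm k C := ⟨h⟩

lemma conv_comm [Coalgebra.IsCocomm k C] (f g : C →ₗ[k] A) : conv f g = conv g f :=
  congrArg ofConv (mul_comm (toConv f) (toConv g))

lemma conv_conv_conv_comm [Coalgebra.IsCocomm k C] (f g f' g' : C →ₗ[k] A) :
    conv (conv f g) (conv f' g') = conv (conv f f') (conv g g') :=
  congrArg ofConv (mul_mul_mul_comm (toConv f) (toConv g) (toConv f') (toConv g'))

/-- `dropL` as a coalgebra homomorphism. -/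
noncomputable def dropLHom (C D : Type) [AddCommGroup C] [Module k C] [Coalgebra k C]
    [AddCommGroup D] [Module k D] [Coalgebra k D] : C ⊗[k] D →ₗc[k] D :=
  (Coalgebra.TensorProduct.lid k D).toCoalgHom.comp
    (CoalgHom.rTensor D (Coalgebra.counitCoalgHom k C))

/-- `dropR` as a coalgebra homomorphism. -/
noncomputable def dropRHom (C D : Type) [AddCommGroup C] [Module k C] [Coalgebra k C]
    [AddCommGroup D] [Module k D] [Coalgebra k D] : C ⊗[k] D →ₗc[k] C :=
  (Coalgebra.TensorProduct.rid k k C).toCoalgHom.comp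
    (CoalgHom.lTensor C (Coalgebra.counitCoalgHom k D))

lemma toLinearMap_dropLHom : (dropLHom C D : C ⊗[k] D →ₗc[k] D).toLinearMap = dropL C D := rfl

lemma dropL_tmul {k C D : Type} [Field k] [AddCommGroup C] [Module k C] [Coalgebra k C]
    [AddCommGroup D] [Module k D] (c : C) (d : D) :
    dropL (k := k) C D (c ⊗ₜ d) = Coalgebra.counit (R := k) c • d := rfl

lemma dropR_tmul {k C D : Type} [Field k] [AddCommGroup C] [Module k C]
    [AddCommGroup D] [Module k D] [Coalgebra k D] (c : C) (d : D) :
    dropR (k := k) C D (c ⊗ₜ d) = Coalgebra.counit (R := k) d • c := rfl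

lemma conv_dropR_dropL_tmul (a : C →ₗ[k] A) (b : D →ₗ[k] A) (c : C) (d : D) :
    conv (a ∘ₗ dropR C D) (b ∘ₗ dropL C D) (c ⊗ₜ d) = a c * b d := by
  have key : conv (a ∘ₗ dropR C D) (b ∘ₗ dropL C D) =
      LinearMap.mul' k A ∘ₗ TensorProduct.map a b := by
    have ha : a ∘ₗ dropR C D = (Algebra.TensorProduct.lmul' k).toLinearMap ∘ₗ
        TensorProduct.map a (convOne (k := k) D A) := by
      ext x y
      simp [dropR_tmul, convOne, Algebra.smul_def, mul_comm]
    have hb : b ∘ₗ dropL C D = (Algebra.TensorProduct.lmul' k).toLinearMap ∘ₗ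
        TensorProduct.map (convOne (k := k) C A) b := by
      ext x y
      simp [dropL_tmul, convOne, Algebra.smul_def]
    have h := LinearMap.algHom_comp_convMul_distrib (Algebra.TensorProduct.lmul' k (S := A))
      (toConv (TensorProduct.map a (convOne (k := k) D A)))
      (toConv (TensorProduct.map (convOne (k := k) C A) b))
    have h' := TensorProduct.map_convMul_map (f := toConv a) (h := toConv (convOne (k := k) C A))
      (g := toConv (convOne (k := k) D A)) (k := toConv b)
    rw [toConv_convOne, toConv_convOne, mul_one, one_mul] at h'
    rw [ha, hb]
    exact h.symm.trans (congrArg (fun F => (Algebra.TensorProduct.lmul' k).toLinearMap ∘ₗ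
      ofConv F) h')
  simp [key]

lemma conv_tmul {ι : Type*} (F G : C ⊗[k] D →ₗ[k] A) {c : C} (𝓡 : Coalgebra.Repr k c ι) (d : D) :
    conv F G (c ⊗ₜ d) = ∑ i ∈ 𝓡.index,
      conv (TensorProduct.curry F (𝓡.left i)) (TensorProduct.curry G (𝓡.right i)) d := by
  simp only [conv, LinearMap.comp_apply, TensorProduct.comul_tmul, ← 𝓡.eq,
    ← (Coalgebra.Repr.arbitrary k d).eq, TensorProduct.sum_tmul, TensorProduct.tmul_sum, map_sum]
  simpa using Finset.sum_comm

end Conv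

section Measuring

variable {k : Type} [Field k] {C : Type} [AddCommGroup C] [Module k C] [Coalgebra k C]
  {A : Type} [CommRing A] [Algebra k A]

lemma Measures.tmul_mul {N : Type} [Ring N] [Bialgebra k N] {ι : Type*} {f : C ⊗[k] N →ₗ[k] A}
    (hf : Measures f) {c : C} (𝓡 : Coalgebra.Repr k c ι) (n n' : N) :
    f (c ⊗ₜ (n * n')) = ∑ i ∈ 𝓡.index, f (𝓡.left i ⊗ₜ n) * f (𝓡.right i ⊗ₜ n') := by
  have h := LinearMap.congr_fun hf.1 (c ⊗ₜ (n ⊗ₜ n'))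
  rw [conv_tmul _ _ 𝓡] at h
  simp only [LinearMap.comp_apply, LinearMap.lTensor_tmul, LinearMap.mul'_apply] at h
  rw [h]
  exact Finset.sum_congr rfl fun i _ => conv_dropR_dropL_tmul
    (TensorProduct.curry f (𝓡.left i)) (TensorProduct.curry f (𝓡.right i)) n n'

lemma Measures.conv {N : Type} [Ring N] [Bialgebra k N] [Coalgebra.IsCocomm k C]
    [Coalgebra.IsCocomm k N] {f g : C ⊗[k] N →ₗ[k] A} (hf : Measures f) (hg : Measures g) :
    Measures (conv f g) := by
  refine ⟨?_, fun c => ?_⟩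
  · have h₁ := conv_comp_coalgHom f g (CoalgHom.lTensor (R := k) C (Bialgebra.mulCoalgHom k N))
    have h₂ := conv_comp_coalgHom f g (CoalgHom.lTensor (R := k) C (dropRHom N N))
    have h₃ := conv_comp_coalgHom f g (CoalgHom.lTensor (R := k) C (dropLHom N N))
    refine h₁.trans (Eq.trans ?_ (congrArg₂ SmashPaper.conv h₂ h₃).symm)
    rw [conv_conv_conv_comm]
    exact congrArg₂ SmashPaper.conv hf.1 hg.1
  · have := LinearMap.congr_fun (conv_one_one (k := k) (C := C) (A := A)) c
    simp only [SmashPaper.conv, convOne, LinearMap.comp_apply, TensorProduct.comul_tmul,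
      ← (Coalgebra.Repr.arbitrary k c).eq, TensorProduct.sum_tmul, map_sum, Bialgebra.comul_one,
      Algebra.TensorProduct.one_def] at this ⊢
    simpa [hf.2, hg.2] using this

lemma Measures.isConvInvertible {N : Type} [Ring N] [HopfAlgebra k N]
    {f : C ⊗[k] N →ₗ[k] A} (hf : Measures f) : IsConvInvertible f := by
  refine ⟨f ∘ₗ LinearMap.lTensor C (HopfAlgebra.antipode k), ?_, ?_⟩
  all_goals
    refine TensorProduct.ext' fun c n => ?_
    have 𝓒 := Coalgebra.Repr.arbitrary k c
    have 𝓝 := Coalgebra.Repr.arbitrary k n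
    rw [conv_tmul _ _ 𝓒]
    simp only [SmashPaper.conv, LinearMap.comp_apply, ← 𝓝.eq, map_sum, TensorProduct.map_tmul,
      LinearMap.mul'_apply, TensorProduct.curry_apply, LinearMap.lTensor_tmul]
    rw [Finset.sum_comm]
    simp only [← hf.tmul_mul 𝓒]
    rw [← map_sum, ← TensorProduct.tmul_sum]
    simp [HopfAlgebra.sum_mul_antipode_eq_algebraMap_counit,
      HopfAlgebra.sum_antipode_mul_eq_algebraMap_counit, Algebra.algebraMap_eq_smul_one, hf.2,
      convOne, smul_smul]

end Measuring

end SmashPaper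

/-- **Proposition (`H¹_meas(T,Hom(N,A)) ≅ P(T,N,A)` for the trivial action).**
Let `N` and `T` be cocommutative Hopf algebras over `k` acting trivially on each other
and `A` a commutative `k`-algebra.  Then measuring 1-coboundaries for the trivial action
`μ(t ⊗ n) = ε(t) n` are trivial, and `H¹_meas(T,Hom(N,A))` is isomorphic to
`P(T,N,A)`, the abelian group (under convolution) of maps `T ⊗ N → A` measuring in both
variables: the measuring 1-cocycles are exactly the elements of `P(T,N,A)`, which are
closed under convolution. -/
theorem H1meas_trivial_action_eq_pairings
    {k : Type} [Field k] {T N A : Type}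
    [Ring T] [HopfAlgebra k T] [Ring N] [HopfAlgebra k N]
    [CommRing A] [Algebra k A]
    (hTcc : IsCocomm k T) (hNcc : IsCocomm k N) :
    -- 1-coboundaries for the trivial action are trivial
    (∀ f : T ⊗[k] N →ₗ[k] A, IsMeasB1 (dropL T N) f → f = convOne (T ⊗[k] N) A)
    -- measuring 1-cocycles = bimeasuring maps
    ∧ (∀ f : T ⊗[k] N →ₗ[k] A, IsMeasZ1 (dropL T N) f ↔ IsBimeasuring f)
    -- `P(T,N,A)` is closed under convolution (an abelian group)
    ∧ (∀ f f' : T ⊗[k] N →ₗ[k] A,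
        IsBimeasuring f → IsBimeasuring f' → IsBimeasuring (conv f f')) := by
  have := hTcc.coalgebra
  have := hNcc.coalgebra
  refine ⟨?_, fun f => ?_, fun f f' hf hf' => ⟨hf.1.conv hf'.1, ?_, ?_⟩⟩
  · rintro f ⟨g, ginv, hg, rfl⟩
    rw [← toLinearMap_dropLHom, ← conv_comp_coalgHom, hg.1, convOne_comp_coalgHom]
  · have hdrop : f ∘ₗ LinearMap.lTensor T (dropL T N) ∘ₗ
        (TensorProduct.assoc k T T N).toLinearMap = f ∘ₗ LinearMap.rTensor N (dropR T T) := by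
      congr 1
      ext t s n
      simp [dropL_tmul, dropR_tmul, TensorProduct.smul_tmul]
    have hcocycle : MeasCocycle1 (dropL T N) f ↔ f ∘ₗ LinearMap.rTensor N (LinearMap.mul' k T) =
        conv (C := (T ⊗[k] T) ⊗[k] N) (f ∘ₗ LinearMap.rTensor N (dropR T T))
          (f ∘ₗ LinearMap.rTensor N (dropL T T)) := by
      rw [MeasCocycle1, hdrop, conv_comm]
    exact ⟨fun h => ⟨h.1.1, h.1.2.1, hcocycle.1 h.2⟩,
      fun h => ⟨⟨h.1, h.2.1, h.1.isConvInvertible⟩, hcocycle.2 h.2.2⟩⟩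
  · intro n
    have := LinearMap.congr_fun (conv_one_one (k := k) (C := N) (A := A)) n
    simp only [conv, convOne, LinearMap.comp_apply, TensorProduct.comul_tmul,
      ← (Coalgebra.Repr.arbitrary k n).eq, TensorProduct.tmul_sum, map_sum, Bialgebra.comul_one,
      Algebra.TensorProduct.one_def] at this ⊢
    simpa [hf.2.1 _, hf'.2.1 _] using this
  · have h₁ := conv_comp_coalgHom f f' (CoalgHom.rTensor (R := k) N (Bialgebra.mulCoalgHom k T))
    have h₂ := conv_comp_coalgHom f f' (CoalgHom.rTensor (R := k) N (dropRHom T T))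
    have h₃ := conv_comp_coalgHom f f' (CoalgHom.rTensor (R := k) N (dropLHom T T))
    refine h₁.trans (Eq.trans ?_ (congrArg₂ conv h₂ h₃).symm)
    rw [conv_conv_conv_comm]
    exact congrArg₂ conv hf.2.2 hf'.2.2
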